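/- Let a > 0. The zero-correlation rate function J_X(y; a, 0) has the following explicit form. Case 1: if |y| > 1/2, then there exists ξ ∈ (0,∞) satisfying (1/(4a))·ξ²/cosh²(ξ/2) + 1/8 − (y²/2)·ξ²/sinh²ξ = 0, and for such ξ, J_X(y; a, 0) = ξ²/2 − ξ·tanh(ξ/2) + a·(ξ/sinh ξ)·(y + sinh ξ/(2ξ))². Case 2: if |y| < 1/2, then there exists λ ∈ (0, π/2) satisfying −(1/a)·λ²/cos²λ + 1/8 − (y²/2)·(2λ)²/sin²(2λ) = 0, and for such λ, J_X(y; a, 0) = 2λ·(tan λ − λ) + a·(2λ/sin 2λ)·(y + sin 2λ/(4λ))². Case 3: J_X(−1/2; a, 0) = 0 and J_X(1/2; a, 0) = a. -/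

import Mathlib

open MeasureTheory ProbabilityTheory Filter Real

/-- The variational rate function `I(u,v)`: infimum of `4∫₀¹ f'(z)² dz` over absolutely
continuous `f : [0,1] → ℝ` (written as `f(z) = ∫₀ᶻ g`) with square-integrable derivative `g`,
`f(0) = 0`, `∫₀¹ e^{2 f(z)} dz = u` and `e^{f(1)} = v`. -/
noncomputable def ratefun (u v : ℝ) : ℝ :=
  sInf {r : ℝ | ∃ g : ℝ → ℝ,
    IntervalIntegrable g volume 0 1 ∧
    IntervalIntegrable (fun z => (g z) ^ 2) volume 0 1 ∧
    (∫ z in (0:ℝ)..(1:ℝ), Real.exp (2 * ∫ t in (0:ℝ)..z, g t)) = u ∧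
    Real.exp (∫ t in (0:ℝ)..(1:ℝ), g t) = v ∧
    r = 4 * ∫ z in (0:ℝ)..(1:ℝ), (g z) ^ 2}

section

open Set Topology

theorem AbsolutelyContinuousOnInterval.comp_contDiffOn {f φ : ℝ → ℝ} {a b m M : ℝ}
    (hf : AbsolutelyContinuousOnInterval f a b) (hφ : ContDiffOn ℝ 1 φ (Icc m M))
    (hmaps : ∀ x ∈ uIcc a b, f x ∈ Icc m M) :
    AbsolutelyContinuousOnInterval (fun x => φ (f x)) a b := by
  obtain ⟨K, hK⟩ := hφ.exists_lipschitzOnWith (by decide) (convex_Icc _ _) isCompact_Icc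
  unfold AbsolutelyContinuousOnInterval at hf ⊢
  refine squeeze_zero' (.of_forall fun _ => Finset.sum_nonneg fun _ _ => dist_nonneg) ?_
    (by simpa using hf.const_mul (K : ℝ))
  rw [eventually_inf_principal]
  filter_upwards with E hE
  rw [Finset.mul_sum]
  exact Finset.sum_le_sum fun i hi =>
    hK.dist_le_mul _ (hmaps _ (hE.1 i hi).1) _ (hmaps _ (hE.1 i hi).2)

theorem AbsolutelyContinuousOnInterval.exp_comp {f : ℝ → ℝ} {a b : ℝ}
    (hf : AbsolutelyContinuousOnInterval f a b) :
    AbsolutelyContinuousOnInterval (fun x => exp (f x)) a b := by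
  obtain ⟨C, hC⟩ := hf.exists_bound
  exact hf.comp_contDiffOn (m := -C) (M := C) contDiff_exp.contDiffOn
    fun x hx => abs_le.1 (hC x hx)

/-- Cauchy–Schwarz for the integral of a function over an interval. -/
theorem sq_integral_abs_le {g : ℝ → ℝ} {s t : ℝ} (hst : s ≤ t)
    (hg : IntervalIntegrable g volume s t)
    (hg2 : IntervalIntegrable (fun z => g z ^ 2) volume s t) :
    (∫ z in s..t, |g z|) ^ 2 ≤ (t - s) * ∫ z in s..t, g z ^ 2 := by
  rcases hst.eq_or_lt with rfl | hlt
  · simp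
  set m := ∫ z in s..t, |g z| with hm
  have h0 : 0 ≤ ∫ z in s..t, ((t - s) * |g z| - m) ^ 2 :=
    intervalIntegral.integral_nonneg hst fun z _ => sq_nonneg _
  have h1 : ∀ z, ((t - s) * |g z| - m) ^ 2
      = (t - s) ^ 2 * g z ^ 2 - 2 * (t - s) * m * |g z| + m ^ 2 := fun z => by
    rw [← sq_abs (g z)]; ring
  simp only [h1] at h0
  rw [intervalIntegral.integral_add ((hg2.const_mul _).sub (hg.abs.const_mul _))
      intervalIntegrable_const, intervalIntegral.integral_sub (hg2.const_mul _)
      (hg.abs.const_mul _), intervalIntegral.integral_const_mul,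
    intervalIntegral.integral_const_mul, intervalIntegral.integral_const, ← hm, smul_eq_mul] at h0
  have : 0 ≤ (t - s) * ((t - s) * (∫ z in s..t, g z ^ 2) - m ^ 2) := by linarith
  linarith [nonneg_of_mul_nonneg_right this (sub_pos.2 hlt)]

theorem tendsto_integral_right_zero {h : ℝ → ℝ} (hh : IntervalIntegrable h volume 0 1) :
    Tendsto (fun t => ∫ z in t..1, h z) (𝓝[<] 1) (𝓝 0) := by
  have hc := (intervalIntegral.continuousOn_primitive_interval_left
    (by rw [uIcc_of_le zero_le_one]
        exact (intervalIntegrable_iff_integrableOn_Icc_of_le zero_le_one).1 hh)) 1 (by simp)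
  have := hc.mono_left (nhdsWithin_mono 1 (uIcc_of_le (zero_le_one' ℝ) ▸ Ico_subset_Icc_self))
  rw [nhdsWithin_Ico_eq_nhdsLT zero_lt_one] at this
  simpa using this

/-- Absolutely continuous paths with square-integrable derivative are `o(√s)`-close to their
terminal value, so the normalised tail integral of `exp (2 * f)` is `s + o(s^(3 / 2))`. -/
theorem tendsto_log_tail_div_sqrt {f g : ℝ → ℝ} (hg : IntervalIntegrable g volume 0 1)
    (hg2 : IntervalIntegrable (fun z => g z ^ 2) volume 0 1)
    (hf : ∀ z ∈ Icc (0 : ℝ) 1, f z = ∫ t in (0 : ℝ)..z, g t) :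
    Tendsto (fun t => log ((∫ z in t..1, exp (2 * f z)) / exp (2 * f t) / (1 - t)) / √(1 - t))
      (𝓝[<] 1) (𝓝 0) := by
  have hlim : Tendsto (fun t => 2 * √(∫ z in t..1, g z ^ 2)) (𝓝[<] 1) (𝓝 0) := by
    simpa using (tendsto_integral_right_zero hg2).sqrt.const_mul 2
  refine squeeze_zero_norm' ?_ hlim
  filter_upwards [Ico_mem_nhdsLT (zero_lt_one' ℝ)] with t ht
  have hs : 0 < 1 - t := sub_pos.2 ht.2
  have hsub : ∀ {x y : ℝ}, 0 ≤ x → x ≤ y → y ≤ 1 → uIcc x y ⊆ uIcc 0 1 := by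
    intro x y h1 h2 h3
    rw [uIcc_of_le h2, uIcc_of_le zero_le_one]; exact Icc_subset_Icc h1 h3
  set m := ∫ z in t..1, |g z| with hm
  have hgt := hg.mono_set (hsub ht.1 ht.2.le le_rfl)
  have hmle : m ≤ √(1 - t) * √(∫ z in t..1, g z ^ 2) := by
    rw [← Real.sqrt_mul hs.le]
    exact Real.le_sqrt_of_sq_le
      (sq_integral_abs_le ht.2.le hgt (hg2.mono_set (hsub ht.1 ht.2.le le_rfl)))
  have hdiff : ∀ z ∈ Icc t 1, |f z - f t| ≤ m := fun z hz => by
    rw [hf z ⟨ht.1.trans hz.1, hz.2⟩, hf t ⟨ht.1, ht.2.le⟩,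
      intervalIntegral.integral_interval_sub_left
        (hg.mono_set (hsub le_rfl (ht.1.trans hz.1) hz.2))
        (hg.mono_set (hsub le_rfl ht.1 ht.2.le))]
    refine (intervalIntegral.abs_integral_le_integral_abs hz.1).trans ?_
    exact intervalIntegral.integral_mono_interval le_rfl hz.1 hz.2
      (.of_forall fun _ => abs_nonneg _) hgt.abs
  have hfc : ContinuousOn f (Icc 0 1) := by
    have := intervalIntegral.continuousOn_primitive_interval (a := 0) (b := 1) (f := g)
      (μ := volume) (by
        rw [uIcc_of_le zero_le_one]
        exact (intervalIntegrable_iff_integrableOn_Icc_of_le zero_le_one).1 hg)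
    rw [uIcc_of_le zero_le_one] at this
    exact this.congr hf
  have hint : IntervalIntegrable (fun z => exp (2 * f z)) volume t 1 := by
    apply ContinuousOn.intervalIntegrable
    rw [uIcc_of_le ht.2.le]
    exact ((hfc.mono (Icc_subset_Icc_left ht.1)).const_mul 2).rexp
  have hq : (∫ z in t..1, exp (2 * f z)) / exp (2 * f t)
      = ∫ z in t..1, exp (2 * (f z - f t)) := by
    rw [← intervalIntegral.integral_div]
    congr 1; ext z; rw [← exp_sub]; ring_nf
  have hint' : IntervalIntegrable (fun z => exp (2 * (f z - f t))) volume t 1 := by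
    convert hint.div_const (exp (2 * f t)) using 2 with z
    rw [← exp_sub]; ring_nf
  have hlo : exp (-(2 * m)) ≤ (∫ z in t..1, exp (2 * (f z - f t))) / (1 - t) := by
    rw [le_div_iff₀ hs]
    have := intervalIntegral.integral_mono_on ht.2.le
      (intervalIntegrable_const (c := exp (-(2 * m)))) hint'
      fun z hz => exp_le_exp.2 (by linarith [(abs_le.1 (hdiff z hz)).1])
    simpa [mul_comm] using this
  have hhi : (∫ z in t..1, exp (2 * (f z - f t))) / (1 - t) ≤ exp (2 * m) := by
    rw [div_le_iff₀ hs]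
    have := intervalIntegral.integral_mono_on ht.2.le hint'
      (intervalIntegrable_const (c := exp (2 * m)))
      fun z hz => exp_le_exp.2 (by linarith [(abs_le.1 (hdiff z hz)).2])
    simpa [mul_comm] using this
  rw [hq, norm_div, Real.norm_eq_abs, Real.norm_eq_abs, abs_of_pos (Real.sqrt_pos.2 hs),
    div_le_iff₀ (Real.sqrt_pos.2 hs)]
  have hpos := (exp_pos _).trans_le hlo
  have : |log ((∫ z in t..1, exp (2 * (f z - f t))) / (1 - t))| ≤ 2 * m :=
    abs_le.2 ⟨(le_log_iff_exp_le hpos).2 hlo, (log_le_iff_le_exp hpos).2 hhi⟩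
  linarith

theorem exists_admissible {u v : ℝ} (hu : 0 < u) (hv : 0 < v) : ∃ g : ℝ → ℝ,
    IntervalIntegrable g volume 0 1 ∧
    IntervalIntegrable (fun z => (g z) ^ 2) volume 0 1 ∧
    (∫ z in (0:ℝ)..(1:ℝ), Real.exp (2 * ∫ t in (0:ℝ)..z, g t)) = u ∧
    Real.exp (∫ t in (0:ℝ)..(1:ℝ), g t) = v := by
  have hcont : Continuous fun x : ℝ =>
      ∫ z in (0:ℝ)..1, exp (2 * (log v * z + x * (z * (1 - z)))) := by
    apply intervalIntegral.continuous_parametric_intervalIntegral_of_continuous'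
    fun_prop
  have hprim : ∀ x z : ℝ, ∫ t in (0:ℝ)..z, (log v + x * (1 - 2 * t))
      = log v * z + x * (z * (1 - z)) := fun x z => by
    rw [intervalIntegral.integral_eq_sub_of_hasDerivAt
      (f := fun z => log v * z + x * (z * (1 - z)))
      (fun t _ => by
        have h := ((hasDerivAt_id t).const_mul (log v)).add
          (((hasDerivAt_id t).mul ((hasDerivAt_id t).const_sub 1)).const_mul x)
        exact h.congr_deriv (by simp only [id]; ring))
        (Continuous.intervalIntegrable (by fun_prop) _ _)]
    simp
  have hlow : ∃ x : ℝ, ∫ z in (0:ℝ)..1, exp (2 * (log v * z + x * (z * (1 - z)))) ≤ u := by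
    have hl : Tendsto (fun x : ℝ => ∫ z in (0:ℝ)..1, exp (2 * (log v * z + x * (z * (1 - z)))))
        atBot (𝓝 (∫ z in (0:ℝ)..1, (0:ℝ))) := by
      refine intervalIntegral.tendsto_integral_filter_of_dominated_convergence
        (fun _ => exp (2 * |log v|)) (.of_forall fun x => ?_) ?_ intervalIntegrable_const ?_
      · exact (Continuous.aestronglyMeasurable (by fun_prop))
      · filter_upwards [eventually_le_atBot (0 : ℝ)] with x hx
        refine .of_forall fun z hz => ?_
        rw [uIoc_of_le zero_le_one] at hz
        rw [norm_of_nonneg (exp_pos _).le, exp_le_exp]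
        have h1 : log v * z ≤ |log v| := by
          nlinarith [le_abs_self (log v), abs_nonneg (log v), hz.1, hz.2]
        have h2 : x * (z * (1 - z)) ≤ 0 :=
          mul_nonpos_of_nonpos_of_nonneg hx (mul_nonneg hz.1.le (by linarith [hz.2]))
        linarith
      · have hne : ∀ᵐ z : ℝ, z ≠ 1 := by simp [ae_iff, measure_singleton]
        filter_upwards [hne] with z hz1 hz
        rw [uIoc_of_le zero_le_one] at hz
        have hpos : 0 < z * (1 - z) :=
          mul_pos hz.1 (sub_pos.2 (lt_of_le_of_ne hz.2 hz1))
        refine tendsto_exp_atBot.comp ?_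
        exact (tendsto_atBot_add_const_left _ _
          (tendsto_id.atBot_mul_const hpos)).const_mul_atBot two_pos
    simp only [intervalIntegral.integral_zero] at hl
    exact (hl.eventually (ge_mem_nhds hu)).exists
  have hhigh : ∃ x : ℝ, u ≤ ∫ z in (0:ℝ)..1, exp (2 * (log v * z + x * (z * (1 - z)))) := by
    refine ⟨3 * (u - 1 - log v), ?_⟩
    set x := 3 * (u - 1 - log v) with hx
    have h1 : ∫ z in (0:ℝ)..1, (2 * (log v * z + x * (z * (1 - z))) + 1) = u := by
      rw [intervalIntegral.integral_eq_sub_of_hasDerivAt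
        (f := fun z => log v * z ^ 2 + x * (z ^ 2 - 2 / 3 * z ^ 3) + z)
        (fun t _ => by
          have h := (((hasDerivAt_pow 2 t).const_mul (log v)).add
            (((hasDerivAt_pow 2 t).sub ((hasDerivAt_pow 3 t).const_mul (2 / 3))).const_mul
              x)).add (hasDerivAt_id t)
          exact h.congr_deriv (by push_cast; ring))
          (Continuous.intervalIntegrable (by fun_prop) _ _)]
      rw [hx]; ring
    rw [← h1]
    exact intervalIntegral.integral_mono_on zero_le_one
      (Continuous.intervalIntegrable (by fun_prop) _ _)
      (Continuous.intervalIntegrable (by fun_prop) _ _) fun z _ => add_one_le_exp _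
  obtain ⟨x, hx⟩ := mem_range_of_exists_le_of_exists_ge hcont hlow hhigh
  refine ⟨fun t => log v + x * (1 - 2 * t), Continuous.intervalIntegrable (by fun_prop) _ _,
    Continuous.intervalIntegrable (by fun_prop) _ _, ?_, ?_⟩
  · simpa only [hprim] using hx
  · rw [hprim]; simp [exp_log hv]

/-- The pair `(S, c)` solves `S' = c`, `c' = κ S`, `S 0 = 0`, `c 0 = 1` and stays positive up to
time `1`; it generates the extremal `z ↦ log (c 1 / c (1 - z))` of the variational problem. -/
structure IsExtremalPair (κ : ℝ) (S c : ℝ → ℝ) : Prop where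
  hasDerivAt_S : ∀ s, HasDerivAt S (c s) s
  hasDerivAt_c : ∀ s, HasDerivAt c (κ * S s) s
  S_zero : S 0 = 0
  c_zero : c 0 = 1
  sq_sub_sq : ∀ s, c s ^ 2 - κ * S s ^ 2 = 1
  c_pos : ∀ s ∈ Icc (0 : ℝ) 1, 0 < c s
  S_pos : ∀ s ∈ Ioc (0 : ℝ) 1, 0 < S s

namespace IsExtremalPair

variable {κ : ℝ} {S c : ℝ → ℝ}

theorem continuous_S (h : IsExtremalPair κ S c) : Continuous S :=
  continuous_iff_continuousAt.2 fun s => (h.hasDerivAt_S s).continuousAt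

theorem continuous_c (h : IsExtremalPair κ S c) : Continuous c :=
  continuous_iff_continuousAt.2 fun s => (h.hasDerivAt_c s).continuousAt

theorem contDiff_S (h : IsExtremalPair κ S c) : ContDiff ℝ 1 S :=
  contDiff_one_iff_deriv.2 ⟨fun s => (h.hasDerivAt_S s).differentiableAt, by
    rw [funext fun s => (h.hasDerivAt_S s).deriv]; exact h.continuous_c⟩

theorem contDiff_c (h : IsExtremalPair κ S c) : ContDiff ℝ 1 c :=
  contDiff_one_iff_deriv.2 ⟨fun s => (h.hasDerivAt_c s).differentiableAt, by
    rw [funext fun s => (h.hasDerivAt_c s).deriv]; exact h.continuous_S.const_mul κ⟩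

theorem c_pos' (h : IsExtremalPair κ S c) {t : ℝ} (ht : t ∈ Icc (0 : ℝ) 1) : 0 < c (1 - t) :=
  h.c_pos _ ⟨by linarith [ht.2], by linarith [ht.1]⟩

theorem S_pos' (h : IsExtremalPair κ S c) {t : ℝ} (ht : t ∈ Ico (0 : ℝ) 1) : 0 < S (1 - t) :=
  h.S_pos _ ⟨by linarith [ht.2], by linarith [ht.1]⟩

theorem c_one_pos (h : IsExtremalPair κ S c) : 0 < c 1 := h.c_pos 1 (by simp)

theorem S_one_pos (h : IsExtremalPair κ S c) : 0 < S 1 := h.S_pos 1 (by simp)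

theorem hasDerivAt_S_rev (h : IsExtremalPair κ S c) (t : ℝ) :
    HasDerivAt (fun t => S (1 - t)) (-c (1 - t)) t := by
  exact ((h.hasDerivAt_S (1 - t)).comp t ((hasDerivAt_id t).const_sub 1)).congr_deriv (by simp)

theorem hasDerivAt_c_rev (h : IsExtremalPair κ S c) (t : ℝ) :
    HasDerivAt (fun t => c (1 - t)) (-(κ * S (1 - t))) t := by
  exact ((h.hasDerivAt_c (1 - t)).comp t ((hasDerivAt_id t).const_sub 1)).congr_deriv (by simp)

/-- Slope of the extremal path. -/
noncomputable def slope (κ : ℝ) (S c : ℝ → ℝ) (t : ℝ) : ℝ := κ * S (1 - t) / c (1 - t)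

theorem continuousOn_slope (h : IsExtremalPair κ S c) : ContinuousOn (slope κ S c) (Icc 0 1) := by
  have hS := h.continuous_S
  have hc := h.continuous_c
  exact ContinuousOn.div (by fun_prop) (by fun_prop) fun t ht => (h.c_pos' ht).ne'

theorem intervalIntegrable_slope (h : IsExtremalPair κ S c) :
    IntervalIntegrable (slope κ S c) volume 0 1 :=
  ContinuousOn.intervalIntegrable (by rw [uIcc_of_le zero_le_one]; exact h.continuousOn_slope)

theorem intervalIntegrable_slope_sq (h : IsExtremalPair κ S c) :
    IntervalIntegrable (fun t => slope κ S c t ^ 2) volume 0 1 :=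
  ContinuousOn.intervalIntegrable (by
    rw [uIcc_of_le zero_le_one]; exact h.continuousOn_slope.pow 2)

theorem integral_slope (h : IsExtremalPair κ S c) {z : ℝ} (hz : z ∈ Icc (0 : ℝ) 1) :
    ∫ t in (0 : ℝ)..z, slope κ S c t = log (c 1 / c (1 - z)) := by
  have hsub : uIcc 0 z ⊆ Icc (0 : ℝ) 1 := by
    rw [uIcc_of_le hz.1]; exact Icc_subset_Icc_right hz.2
  rw [intervalIntegral.integral_eq_sub_of_hasDerivAt (f := fun t => -log (c (1 - t)))
    (fun t ht => by
      refine ((h.hasDerivAt_c_rev t).log (h.c_pos' (hsub ht)).ne').neg.congr_deriv ?_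
      simp only [slope]; ring)
    (h.continuousOn_slope.mono hsub).intervalIntegrable,
    log_div h.c_one_pos.ne' (h.c_pos' hz).ne']
  simp only [sub_zero]; ring

theorem hasDerivAt_S_div_c_rev (h : IsExtremalPair κ S c) {t : ℝ} (ht : t ∈ Icc (0 : ℝ) 1) :
    HasDerivAt (fun t => S (1 - t) / c (1 - t)) (-(1 / c (1 - t) ^ 2)) t := by
  have hc := (h.c_pos' ht).ne'
  refine ((h.hasDerivAt_S_rev t).div (h.hasDerivAt_c_rev t) hc).congr_deriv ?_
  rw [← neg_div]
  congr 1
  linear_combination (-1) * h.sq_sub_sq (1 - t)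

theorem exp_two_mul_log (h : IsExtremalPair κ S c) {z : ℝ} (hz : z ∈ Icc (0 : ℝ) 1) :
    exp (2 * log (c 1 / c (1 - z))) = c 1 ^ 2 / c (1 - z) ^ 2 := by
  rw [two_mul, exp_add, exp_log (div_pos h.c_one_pos (h.c_pos' hz))]; ring

theorem integral_tail (h : IsExtremalPair κ S c) {t : ℝ} (ht : t ∈ Icc (0 : ℝ) 1) :
    ∫ z in t..1, exp (2 * log (c 1 / c (1 - z))) = c 1 ^ 2 * (S (1 - t) / c (1 - t)) := by
  have hsub : uIcc t 1 ⊆ Icc (0 : ℝ) 1 := by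
    rw [uIcc_of_le ht.2]; exact Icc_subset_Icc_left ht.1
  have hc := h.continuous_c
  have hint : IntervalIntegrable (fun z => c 1 ^ 2 / c (1 - z) ^ 2) volume t 1 :=
    ContinuousOn.intervalIntegrable (ContinuousOn.div (by fun_prop) (by fun_prop)
      fun z hz => pow_ne_zero 2 (h.c_pos' (hsub hz)).ne')
  rw [intervalIntegral.integral_congr (g := fun z => c 1 ^ 2 / c (1 - z) ^ 2)
      fun z hz => h.exp_two_mul_log (hsub hz),
    intervalIntegral.integral_eq_sub_of_hasDerivAt
      (f := fun t => -(c 1 ^ 2 * (S (1 - t) / c (1 - t))))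
    (fun z hz => by
      refine ((h.hasDerivAt_S_div_c_rev (hsub hz)).const_mul (c 1 ^ 2)).neg.congr_deriv ?_
      ring)
    hint]
  simp [h.S_zero]

theorem integral_slope_sq (h : IsExtremalPair κ S c) :
    ∫ t in (0 : ℝ)..1, slope κ S c t ^ 2 = κ * (1 - S 1 / c 1) := by
  rw [intervalIntegral.integral_eq_sub_of_hasDerivAt
    (f := fun t => κ * (t + S (1 - t) / c (1 - t)))
    (fun t ht => by
      rw [uIcc_of_le zero_le_one] at ht
      have hc := (h.c_pos' ht).ne'
      refine (((hasDerivAt_id t).add (h.hasDerivAt_S_div_c_rev ht)).const_mul κ).congr_deriv ?_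
      simp only [slope]
      field_simp
      linear_combination κ * h.sq_sub_sq (1 - t))
    h.intervalIntegrable_slope_sq]
  simp [h.S_zero]; ring

/-- The calibration: a function of time, position `x` and remaining mass `w` whose increments along
any path are bounded below by the difference of the energies of the extremal and of the path. -/
noncomputable def calib (κ : ℝ) (S c : ℝ → ℝ) (t x w : ℝ) : ℝ :=
  (c (1 - t) ^ 2 + κ * S (1 - t) ^ 2) / (S (1 - t) * c (1 - t))
      * (log w - 2 * x - log (S (1 - t) * c (1 - t)))
    + exp (2 * x) / w - 1 / (S (1 - t) * c (1 - t))

theorem hasDerivAt_calib (h : IsExtremalPair κ S c) {t : ℝ} (ht : t ∈ Ico (0 : ℝ) 1)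
    {f w : ℝ → ℝ} {p : ℝ} (hf : HasDerivAt f p t) (hw : HasDerivAt w (-exp (2 * f t)) t)
    (hwt : 0 < w t) :
    ∃ d, HasDerivAt (fun t => calib κ S c t (f t) (w t)) d t ∧
      2 * slope κ S c t ^ 2 - 2 * p ^ 2 ≤ d := by
  have hS := h.S_pos' ht
  have hc := h.c_pos' (Ico_subset_Icc_self ht)
  have hSd := h.hasDerivAt_S_rev t
  have hcd := h.hasDerivAt_c_rev t
  have hq := hSd.mul hcd
  have hq0 : S (1 - t) * c (1 - t) ≠ 0 := (mul_pos hS hc).ne'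
  have hD := (((((hcd.pow 2).add ((hSd.pow 2).const_mul κ)).div hq hq0).mul
    (((hw.log hwt.ne').sub (hf.const_mul 2)).sub (hq.log hq0))).add
    (((hf.const_mul 2).exp).div hw hwt.ne')).sub ((hasDerivAt_const t (1 : ℝ)).div hq hq0)
  refine ⟨_, hD, ?_⟩
  have hpy := h.sq_sub_sq (1 - t)
  simp only [slope, Pi.mul_apply, Pi.add_apply, Pi.pow_apply, Pi.sub_apply, Pi.div_apply]
  set s := S (1 - t)
  set k := c (1 - t)
  set E := exp (2 * f t) with hE
  have hEpos : 0 < E := exp_pos _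
  set x := E / w t with hx
  set b := 1 / (s * k) with hb
  have hbpos : 0 < b := by positivity
  have hxpos : 0 < x := by positivity
  have hlog : log (w t) - 2 * f t - log (s * k) = -log (x / b) := by
    have : x / b = E * (s * k) / w t := by rw [hx, hb]; field_simp
    rw [this, log_div (by positivity) hwt.ne', log_mul hEpos.ne' hq0, hE, log_exp]; ring
  have hkey : b ^ 2 * log (x / b) ≤ (x ^ 2 - b ^ 2) / 2 := by
    have h1 := log_le_sub_one_of_pos (pow_pos (div_pos hxpos hbpos) 2)
    rw [log_pow] at h1
    have h2 : b ^ 2 * (x / b) ^ 2 = x ^ 2 := by field_simp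
    push_cast at h1
    nlinarith [mul_le_mul_of_nonneg_left h1 (sq_nonneg b)]
  set ρ := (k ^ 2 + κ * s ^ 2) / (s * k) with hρ
  have e1 : κ * s / k = (ρ - b) / 2 := by
    rw [hρ, hb]; field_simp; linear_combination -hpy
  have e2 : (((2 : ℕ) : ℝ) * k ^ (2 - 1) * -(κ * s) + κ * (((2 : ℕ) : ℝ) * s ^ (2 - 1) * -k))
      * (s * k) - (k ^ 2 + κ * s ^ 2) * (-k * k + s * -(κ * s)) = 1 := by
    push_cast
    linear_combination (k ^ 2 - κ * s ^ 2 + 1) * hpy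
  have e3 : (-k * k + s * -(κ * s)) / (s * k) = -ρ := by rw [hρ]; ring
  have e4 : (0 * (s * k) - 1 * (-k * k + s * -(κ * s))) / (s * k) ^ 2 = ρ * b := by
    rw [hρ, hb]; field_simp; ring
  have e5 : (E * (2 * p) * w t - E * -E) / w t ^ 2 = 2 * p * x + x ^ 2 := by
    rw [hx]; field_simp; ring
  have e6 : 1 / (s * k) ^ 2 = b ^ 2 := by rw [hb, one_div_pow]
  rw [e1, e2, e3, e4, e5, e6, hlog, neg_div, ← hx]
  nlinarith [sq_nonneg (2 * p + x - ρ)]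

theorem absolutelyContinuousOnInterval_calib (h : IsExtremalPair κ S c) {T : ℝ}
    (hT : T ∈ Ico (0 : ℝ) 1) {f w : ℝ → ℝ} {m M : ℝ} (hm : 0 < m)
    (hf : AbsolutelyContinuousOnInterval f 0 T) (hw : AbsolutelyContinuousOnInterval w 0 T)
    (hwm : ∀ t ∈ Icc 0 T, w t ∈ Icc m M) :
    AbsolutelyContinuousOnInterval (fun t => calib κ S c t (f t) (w t)) 0 T := by
  have hu : uIcc 0 T = Icc 0 T := uIcc_of_le hT.1
  have hq : ∀ t ∈ uIcc 0 T, S (1 - t) * c (1 - t) ≠ 0 := fun t ht => by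
    rw [hu] at ht
    have ht' : t ∈ Ico (0 : ℝ) 1 := ⟨ht.1, ht.2.trans_lt hT.2⟩
    exact (mul_pos (h.S_pos' ht') (h.c_pos' (Ico_subset_Icc_self ht'))).ne'
  have hS : ContDiff ℝ 1 fun t => S (1 - t) := h.contDiff_S.comp (contDiff_const.sub contDiff_id)
  have hc : ContDiff ℝ 1 fun t => c (1 - t) := h.contDiff_c.comp (contDiff_const.sub contDiff_id)
  have hm0 : ∀ x ∈ Icc m M, x ≠ 0 := fun x hx => (hm.trans_le hx.1).ne'
  have h1 : AbsolutelyContinuousOnInterval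
      (fun t => (c (1 - t) ^ 2 + κ * S (1 - t) ^ 2) / (S (1 - t) * c (1 - t))) 0 T :=
    (((hc.pow 2).add (contDiff_const.mul (hS.pow 2))).contDiffOn.div
      (hS.mul hc).contDiffOn hq).absolutelyContinuousOnInterval
  have h2 : AbsolutelyContinuousOnInterval (fun t => log (S (1 - t) * c (1 - t))) 0 T :=
    ((hS.mul hc).contDiffOn.log hq).absolutelyContinuousOnInterval
  have h3 : AbsolutelyContinuousOnInterval (fun t => 1 / (S (1 - t) * c (1 - t))) 0 T :=
    (contDiffOn_const.div (hS.mul hc).contDiffOn hq).absolutelyContinuousOnInterval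
  have h4 : AbsolutelyContinuousOnInterval (fun t => log (w t)) 0 T :=
    hw.comp_contDiffOn (contDiffOn_id.log hm0) (by rwa [hu])
  have h5 : AbsolutelyContinuousOnInterval (fun t => (w t)⁻¹) 0 T :=
    hw.comp_contDiffOn (contDiffOn_id.inv hm0) (by rwa [hu])
  have h6 := (hf.const_mul 2).exp_comp
  exact ((h1.fun_mul ((h4.fun_sub (hf.const_mul 2)).fun_sub h2)).fun_add
    (h6.fun_mul h5)).fun_sub h3

theorem tendsto_calib (h : IsExtremalPair κ S c) {f g : ℝ → ℝ}
    (hg : IntervalIntegrable g volume 0 1)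
    (hg2 : IntervalIntegrable (fun z => g z ^ 2) volume 0 1)
    (hf : ∀ z ∈ Icc (0 : ℝ) 1, f z = ∫ t in (0 : ℝ)..z, g t)
    (hw : ∀ t ∈ Ico (0 : ℝ) 1, 0 < ∫ z in t..1, exp (2 * f z)) :
    Tendsto (fun t => calib κ S c t (f t) (∫ z in t..1, exp (2 * f z))) (𝓝[<] 1) (𝓝 0) := by
  have hA := tendsto_log_tail_div_sqrt hg hg2 hf
  have hB := tendsto_log_tail_div_sqrt h.intervalIntegrable_slope h.intervalIntegrable_slope_sq
    fun z hz => (h.integral_slope hz).symm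
  have hsqrt : Tendsto (fun t : ℝ => √(1 - t)) (𝓝[<] 1) (𝓝 0) := by
    have : Tendsto (fun t : ℝ => √(1 - t)) (𝓝 1) (𝓝 (√(1 - 1))) :=
      Continuous.tendsto (by fun_prop) 1
    simpa using this.mono_left nhdsWithin_le_nhds
  set α : ℝ → ℝ := fun t =>
    log ((∫ z in t..1, exp (2 * f z)) / exp (2 * f t) / (1 - t)) / √(1 - t) with hα
  set β : ℝ → ℝ := fun t => log ((∫ z in t..1, exp (2 * log (c 1 / c (1 - z))))
    / exp (2 * log (c 1 / c (1 - t))) / (1 - t)) / √(1 - t) with hβ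
  have hδ : Tendsto (fun t => √(1 - t) * (α t - β t)) (𝓝[<] 1) (𝓝 0) := by
    simpa using hsqrt.mul (hA.sub hB)
  have hslope : Tendsto (fun t => 2 * slope κ S c t) (𝓝[<] 1) (𝓝 0) := by
    have h1 := (h.continuousOn_slope 1 (by simp)).mono_left
      (nhdsWithin_mono 1 (show Ico (0 : ℝ) 1 ⊆ Icc 0 1 from Ico_subset_Icc_self))
    rw [nhdsWithin_Ico_eq_nhdsLT zero_lt_one] at h1
    simpa [slope, h.S_zero] using h1.const_mul 2
  have hb : Tendsto (fun t => exp (-(√(1 - t) * β t))) (𝓝[<] 1) (𝓝 1) := by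
    simpa using (hsqrt.mul hB).neg.rexp
  have hbound : Tendsto (fun t => |2 * slope κ S c t * (√(1 - t) * (α t - β t))|
      + exp (-(√(1 - t) * β t)) * (α t - β t) ^ 2) (𝓝[<] 1) (𝓝 0) := by
    simpa using (hslope.mul hδ).abs.add (hb.mul ((hA.sub hB).pow 2))
  refine squeeze_zero_norm' ?_ hbound
  have hsmall : ∀ᶠ t in 𝓝[<] (1 : ℝ), |√(1 - t) * (α t - β t)| < 1 :=
    hδ.abs.eventually (gt_mem_nhds (by simp))
  filter_upwards [hsmall, Ico_mem_nhdsLT (zero_lt_one' ℝ)] with t hsm ht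
  have hs : 0 < 1 - t := sub_pos.2 ht.2
  have hsq : 0 < √(1 - t) := Real.sqrt_pos.2 hs
  have hS := h.S_pos' ht
  have hc := h.c_pos' (Ico_subset_Icc_self ht)
  have hq := mul_pos hS hc
  have hwt := hw t ht
  set w := ∫ z in t..1, exp (2 * f z)
  have hβt : √(1 - t) * β t = log (S (1 - t) * c (1 - t) / (1 - t)) := by
    rw [hβ]
    simp only
    rw [mul_div_cancel₀ _ hsq.ne', h.integral_tail (Ico_subset_Icc_self ht),
      h.exp_two_mul_log (Ico_subset_Icc_self ht)]
    have := h.c_one_pos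
    congr 2
    field_simp
  have hαt : √(1 - t) * α t = log w - 2 * f t - log (1 - t) := by
    rw [hα]
    simp only
    rw [mul_div_cancel₀ _ hsq.ne', log_div (by positivity) hs.ne',
      log_div hwt.ne' (exp_pos _).ne', log_exp]
  set δ := √(1 - t) * (α t - β t) with hδt
  have hδe : log w - 2 * f t - log (S (1 - t) * c (1 - t)) = δ := by
    rw [hδt, mul_sub, hαt, hβt, log_div hq.ne' hs.ne']; ring
  have hx : exp (2 * f t) / w = exp (-δ) / (S (1 - t) * c (1 - t)) := by
    rw [← hδe, show -(log w - 2 * f t - log (S (1 - t) * c (1 - t)))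
      = 2 * f t - log w + log (S (1 - t) * c (1 - t)) by ring, exp_add, exp_sub, exp_log hwt,
      exp_log hq]
    field_simp
  have hcal : calib κ S c t (f t) w = 2 * slope κ S c t * δ
      + (exp (-δ) - 1 - -δ) / (S (1 - t) * c (1 - t)) := by
    rw [calib, hδe, hx, slope]
    field_simp
    linear_combination δ * h.sq_sub_sq (1 - t)
  rw [hcal]
  refine (norm_add_le _ _).trans (add_le_add le_rfl ?_)
  have hexp := Real.abs_exp_sub_one_sub_id_le (x := -δ) (by rw [abs_neg]; exact hsm.le)
  rw [norm_div, Real.norm_of_nonneg hq.le, Real.norm_eq_abs, hβt, ← log_inv, inv_div,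
    exp_log (div_pos hs hq)]
  refine (div_le_div_of_nonneg_right hexp hq.le).trans_eq ?_
  rw [neg_sq, hδt, mul_pow, Real.sq_sqrt hs.le]
  ring

theorem energy_ge (h : IsExtremalPair κ S c) {g : ℝ → ℝ}
    (hg : IntervalIntegrable g volume 0 1)
    (hg2 : IntervalIntegrable (fun z => g z ^ 2) volume 0 1) :
    2 * κ * (1 - S 1 / c 1)
        + calib κ S c 0 0 (∫ z in (0 : ℝ)..1, exp (2 * ∫ t in (0 : ℝ)..z, g t))
      ≤ 2 * ∫ z in (0 : ℝ)..1, g z ^ 2 := by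
  set f : ℝ → ℝ := fun z => ∫ t in (0 : ℝ)..z, g t with hf
  have h01 : uIcc (0 : ℝ) 1 = Icc 0 1 := uIcc_of_le zero_le_one
  have hfac : AbsolutelyContinuousOnInterval f 0 1 :=
    hg.absolutelyContinuousOnInterval_intervalIntegral (by simp)
  have hEc : ContinuousOn (fun z => exp (2 * f z)) (Icc 0 1) :=
    ((h01 ▸ hfac.continuousOn).const_mul 2).rexp
  have hsub : ∀ {x y : ℝ}, 0 ≤ x → x ≤ y → y ≤ 1 → uIcc x y ⊆ Icc 0 1 := by
    intro x y h1 h2 h3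
    rw [uIcc_of_le h2]; exact Icc_subset_Icc h1 h3
  have hEi : ∀ {x y : ℝ}, 0 ≤ x → x ≤ y → y ≤ 1 →
      IntervalIntegrable (fun z => exp (2 * f z)) volume x y := fun h1 h2 h3 =>
    (hEc.mono (hsub h1 h2 h3)).intervalIntegrable
  set w : ℝ → ℝ := fun t => ∫ z in t..1, exp (2 * f z) with hw
  have hwpos : ∀ t ∈ Ico (0 : ℝ) 1, 0 < w t := fun t ht =>
    intervalIntegral.intervalIntegral_pos_of_pos (hEi ht.1 ht.2.le le_rfl)
      (fun _ => exp_pos _) ht.2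
  have hwac : AbsolutelyContinuousOnInterval w 0 1 := by
    have h1 := ((hEi le_rfl zero_le_one
      le_rfl).absolutelyContinuousOnInterval_intervalIntegral (c := 1) (by simp)).fun_neg
    simpa only [← intervalIntegral.integral_symm] using h1
  have hwanti : ∀ {x y : ℝ}, 0 ≤ x → x ≤ y → y ≤ 1 → w y ≤ w x := fun h1 h2 h3 =>
    intervalIntegral.integral_mono_interval h2 h3 le_rfl
      (.of_forall fun _ => (exp_pos _).le) (hEi h1 (h2.trans h3) le_rfl)
  have hderiv : ∀ᵐ t : ℝ, t ∈ Ioo (0 : ℝ) 1 → HasDerivAt f (g t) t := by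
    filter_upwards [hg.ae_hasDerivAt_integral] with t ht htI
    exact ht (h01 ▸ Ioo_subset_Icc_self htI) 0 (by simp)
  have hwderiv : ∀ t ∈ Ioo (0 : ℝ) 1, HasDerivAt w (-exp (2 * f t)) t := fun t ht =>
    intervalIntegral.integral_hasDerivAt_left (hEi ht.1.le ht.2.le le_rfl)
      (hEc.stronglyMeasurableAtFilter_nhdsWithin measurableSet_Icc t |> fun hh => by
        rwa [nhdsWithin_eq_nhds.2 (Icc_mem_nhds ht.1 ht.2)] at hh)
      (hEc.continuousAt (Icc_mem_nhds ht.1 ht.2))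
  have hg0 := h.intervalIntegrable_slope_sq
  have hlocal : ∀ T ∈ Ico (0 : ℝ) 1,
      ∫ t in (0 : ℝ)..T, (2 * slope κ S c t ^ 2 - 2 * g t ^ 2)
        ≤ calib κ S c T (f T) (w T) - calib κ S c 0 (f 0) (w 0) := fun T hT => by
    have hs : uIcc 0 T ⊆ uIcc (0 : ℝ) 1 := h01 ▸ hsub le_rfl hT.1 hT.2.le
    have hac := h.absolutelyContinuousOnInterval_calib hT (hwpos T hT) (hfac.mono hs)
      (hwac.mono hs) fun t ht => ⟨hwanti ht.1 ht.2 hT.2.le,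
        hwanti le_rfl ht.1 (ht.2.trans hT.2.le)⟩
    rw [← hac.integral_deriv_eq_sub]
    refine intervalIntegral.integral_mono_ae_restrict hT.1
      (((hg0.mono_set hs).const_mul 2).sub ((hg2.mono_set hs).const_mul 2))
      hac.intervalIntegrable_deriv ?_
    rw [← restrict_Ioo_eq_restrict_Icc, EventuallyLE, ae_restrict_iff' measurableSet_Ioo]
    filter_upwards [hderiv] with t ht htT
    have htI : t ∈ Ioo (0 : ℝ) 1 := ⟨htT.1, htT.2.trans hT.2⟩
    obtain ⟨d, hd, hle⟩ := h.hasDerivAt_calib (Ioo_subset_Ico_self htI) (ht htI)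
      (hwderiv t htI) (hwpos t (Ioo_subset_Ico_self htI))
    rwa [hd.deriv]
  have hlim1 : Tendsto (fun T => ∫ t in (0 : ℝ)..T, (2 * slope κ S c t ^ 2 - 2 * g t ^ 2))
      (𝓝[<] 1) (𝓝 (∫ t in (0 : ℝ)..1, (2 * slope κ S c t ^ 2 - 2 * g t ^ 2))) := by
    have hc := (((hg0.const_mul 2).sub
      (hg2.const_mul 2)).absolutelyContinuousOnInterval_intervalIntegral (c := 0)
      (by simp)).continuousOn 1 (by simp)
    have := hc.mono_left (nhdsWithin_mono 1 (h01 ▸ Ico_subset_Icc_self))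
    rwa [nhdsWithin_Ico_eq_nhdsLT zero_lt_one] at this
  have hlim2 := (h.tendsto_calib hg hg2 (fun z _ => rfl) hwpos).sub_const
    (calib κ S c 0 (f 0) (w 0))
  have hfin := le_of_tendsto_of_tendsto hlim1 hlim2 (by
    filter_upwards [Ico_mem_nhdsLT (zero_lt_one' ℝ)] with T hT using hlocal T hT)
  rw [intervalIntegral.integral_sub (hg0.const_mul 2) (hg2.const_mul 2),
    intervalIntegral.integral_const_mul, intervalIntegral.integral_const_mul,
    h.integral_slope_sq, show f 0 = 0 from intervalIntegral.integral_same] at hfin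
  linarith

end IsExtremalPair

theorem ratefun_nonneg (u v : ℝ) : 0 ≤ ratefun u v := by
  refine Real.sInf_nonneg ?_
  rintro r ⟨g, -, -, -, -, rfl⟩
  exact mul_nonneg zero_le_four
    (intervalIntegral.integral_nonneg zero_le_one fun z _ => sq_nonneg _)

theorem ratefun_le {g : ℝ → ℝ} (hg : IntervalIntegrable g volume 0 1)
    (hg2 : IntervalIntegrable (fun z => g z ^ 2) volume 0 1) :
    ratefun (∫ z in (0:ℝ)..1, exp (2 * ∫ t in (0:ℝ)..z, g t)) (exp (∫ t in (0:ℝ)..1, g t))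
      ≤ 4 * ∫ z in (0:ℝ)..1, g z ^ 2 := by
  refine csInf_le ⟨0, ?_⟩ ⟨g, hg, hg2, rfl, rfl, rfl⟩
  rintro r ⟨g, -, -, -, -, rfl⟩
  exact mul_nonneg zero_le_four
    (intervalIntegral.integral_nonneg zero_le_one fun z _ => sq_nonneg _)

theorem le_ratefun {u v b : ℝ} (hu : 0 < u) (hv : 0 < v)
    (h : ∀ g : ℝ → ℝ, IntervalIntegrable g volume 0 1 →
      IntervalIntegrable (fun z => g z ^ 2) volume 0 1 →
      (∫ z in (0:ℝ)..1, exp (2 * ∫ t in (0:ℝ)..z, g t)) = u →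
      b ≤ 4 * ∫ z in (0:ℝ)..1, g z ^ 2) : b ≤ ratefun u v := by
  obtain ⟨g, hg, hg2, hgu, hgv⟩ := exists_admissible hu hv
  refine le_csInf ⟨_, g, hg, hg2, hgu, hgv, rfl⟩ ?_
  rintro r ⟨g, hg, hg2, hgu, -, rfl⟩
  exact h g hg hg2 hgu

/-- An extremal pair satisfying the transversality condition at the free endpoint computes the
infimum. -/
theorem IsExtremalPair.sInf_eq {κ : ℝ} {S c : ℝ → ℝ} (h : IsExtremalPair κ S c) {a y : ℝ}
    (ha : 0 < a) (htr : 2 * κ * (S 1 / c 1) = a * (y ^ 2 / (S 1 * c 1) - S 1 * c 1 / 4)) :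
    sInf {r : ℝ | ∃ u v : ℝ, 0 < u ∧ 0 < v ∧
        r = (1 / 2) * ratefun u v + (a / u) * (y + u / 2) ^ 2}
      = 2 * κ * (1 - S 1 / c 1) + a / (S 1 * c 1) * (y + S 1 * c 1 / 2) ^ 2 := by
  have hS := h.S_one_pos
  have hc := h.c_one_pos
  have hq := mul_pos hS hc
  have hnn : ∀ r ∈ {r : ℝ | ∃ u v : ℝ, 0 < u ∧ 0 < v ∧
      r = (1 / 2) * ratefun u v + (a / u) * (y + u / 2) ^ 2}, 0 ≤ r := by
    rintro r ⟨u, v, hu, hv, rfl⟩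
    have := ratefun_nonneg u v
    positivity
  have hmass : ∫ z in (0:ℝ)..1, exp (2 * ∫ t in (0:ℝ)..z, slope κ S c t) = S 1 * c 1 := by
    rw [intervalIntegral.integral_congr (g := fun z => exp (2 * log (c 1 / c (1 - z))))
      fun z hz => by
        rw [uIcc_of_le zero_le_one] at hz
        simp only [h.integral_slope hz], h.integral_tail (by simp), sub_zero]
    field_simp
  apply le_antisymm
  · have hle := ratefun_le h.intervalIntegrable_slope h.intervalIntegrable_slope_sq
    rw [hmass, h.integral_slope_sq] at hle
    refine (csInf_le ⟨0, hnn⟩ ⟨_, _, hq, exp_pos (∫ t in (0:ℝ)..1, slope κ S c t), rfl⟩).trans ?_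
    linarith
  · refine le_csInf ⟨_, 1, 1, one_pos, one_pos, rfl⟩ ?_
    rintro r ⟨u, v, hu, hv, rfl⟩
    have hrate := le_ratefun (b := 2 * (2 * κ * (1 - S 1 / c 1) + calib κ S c 0 0 u)) hu hv
      fun g hg hg2 hgu => by
        have := h.energy_ge hg hg2
        rw [hgu] at this
        linarith
    set q := S 1 * c 1 with hqd
    have hcal : calib κ S c 0 0 u
        = (2 * κ * (S 1 / c 1) + 1 / q) * log (u / q) + 1 / u - 1 / q := by
      rw [log_div hu.ne' hq.ne']
      simp only [calib, sub_zero, mul_zero, exp_zero, ← hqd]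
      congr 3
      rw [hqd]
      field_simp
      linear_combination h.sq_sub_sq 1
    rw [hcal, htr] at hrate
    set L := log (u / q) with hL
    have h1 : 1 - q / u ≤ L := by
      simpa [inv_div] using one_sub_inv_le_log_of_pos (div_pos hu hq)
    have h2 : L ≤ u / q - 1 := log_le_sub_one_of_pos (div_pos hu hq)
    have e1 : 0 ≤ (a * y ^ 2 + 1) / q * (L - (1 - q / u)) :=
      mul_nonneg (by positivity) (sub_nonneg.2 h1)
    have e2 : 0 ≤ a * q / 4 * (u / q - 1 - L) := mul_nonneg (by positivity) (sub_nonneg.2 h2)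
    have e3 : (a / u) * (y + u / 2) ^ 2 - a / q * (y + q / 2) ^ 2
        + ((a * (y ^ 2 / q - q / 4) + 1 / q) * L + 1 / u - 1 / q)
        = (a * y ^ 2 + 1) / q * (L - (1 - q / u)) + a * q / 4 * (u / q - 1 - L) := by
      field_simp
      ring
    linarith

theorem isExtremalPair_id : IsExtremalPair 0 (fun s => s) fun _ => 1 where
  hasDerivAt_S s := hasDerivAt_id s
  hasDerivAt_c s := by simpa using hasDerivAt_const s (1 : ℝ)
  S_zero := rfl
  c_zero := rfl
  sq_sub_sq s := by simp
  c_pos _ _ := one_pos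
  S_pos s hs := hs.1

theorem isExtremalPair_sinh {k : ℝ} (hk : 0 < k) :
    IsExtremalPair (k ^ 2) (fun s => sinh (k * s) / k) fun s => cosh (k * s) where
  hasDerivAt_S s := by
    refine (((hasDerivAt_id s).const_mul k).sinh.div_const k).congr_deriv ?_
    simp only [id]; field_simp
  hasDerivAt_c s := by
    refine ((hasDerivAt_id s).const_mul k).cosh.congr_deriv ?_
    simp only [id]; field_simp
  S_zero := by simp
  c_zero := by simp
  sq_sub_sq s := by
    have := cosh_sq (k * s)
    field_simp
    linarith
  c_pos _ _ := cosh_pos _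
  S_pos s hs := div_pos (sinh_pos_iff.2 (mul_pos hk hs.1)) hk

theorem isExtremalPair_sin {l : ℝ} (hl : l ∈ Ioo 0 (π / 2)) :
    IsExtremalPair (-l ^ 2) (fun s => sin (l * s) / l) fun s => cos (l * s) where
  hasDerivAt_S s := by
    have := hl.1.ne'
    refine (((hasDerivAt_id s).const_mul l).sin.div_const l).congr_deriv ?_
    simp only [id]; field_simp
  hasDerivAt_c s := by
    have := hl.1.ne'
    refine ((hasDerivAt_id s).const_mul l).cos.congr_deriv ?_
    simp only [id]; field_simp
  S_zero := by simp
  c_zero := by simp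
  sq_sub_sq s := by
    have := hl.1.ne'
    have := sin_sq_add_cos_sq (l * s)
    field_simp
    linarith
  c_pos s hs := cos_pos_of_mem_Ioo
    ⟨by nlinarith [hl.1, hs.1, pi_pos], by nlinarith [hl.1, hl.2, hs.2]⟩
  S_pos s hs := div_pos (sin_pos_of_pos_of_lt_pi (mul_pos hl.1 hs.1)
    (by nlinarith [hl.1, hl.2, hs.2, pi_pos])) hl.1

theorem tendsto_div_sinh : Tendsto (fun x => x / sinh x) (𝓝[>] 0) (𝓝 1) := by
  have h : Tendsto (slope sinh 0) (𝓝[>] 0) (𝓝 (cosh 0)) :=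
    (hasDerivAt_iff_tendsto_slope.1 (hasDerivAt_sinh 0)).mono_left
      (nhdsWithin_mono 0 fun x (hx : x ∈ Ioi 0) => ne_of_gt hx)
  simpa [slope_fun_def_field, inv_div] using h.inv₀ (by simp)

theorem tendsto_div_sin : Tendsto (fun x => x / sin x) (𝓝[>] 0) (𝓝 1) := by
  have h : Tendsto (slope sin 0) (𝓝[>] 0) (𝓝 (cos 0)) :=
    (hasDerivAt_iff_tendsto_slope.1 (hasDerivAt_sin 0)).mono_left
      (nhdsWithin_mono 0 fun x (hx : x ∈ Ioi 0) => ne_of_gt hx)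
  simpa [slope_fun_def_field, inv_div] using h.inv₀ (by simp)

theorem exists_hyperbolic_root {a y : ℝ} (ha : 0 < a) (hy : 1 / 2 < |y|) :
    ∃ ξ : ℝ, 0 < ξ ∧
        (1 / (4 * a)) * ξ ^ 2 / cosh (ξ / 2) ^ 2 + 1 / 8
          - (y ^ 2 / 2) * ξ ^ 2 / sinh ξ ^ 2 = 0 := by
  set F : ℝ → ℝ := fun ξ => (1 / (4 * a)) * ξ ^ 2 / cosh (ξ / 2) ^ 2 + 1 / 8
          - (y ^ 2 / 2) * ξ ^ 2 / sinh ξ ^ 2 with hF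
  have hcont : ContinuousOn F (Ioi 0) := by
    refine ContinuousOn.sub (ContinuousOn.add (ContinuousOn.div (by fun_prop) (by fun_prop) ?_)
      continuousOn_const) (ContinuousOn.div (by fun_prop) (by fun_prop) ?_)
    · exact fun x _ => pow_ne_zero 2 (cosh_pos _).ne'
    · exact fun x hx => pow_ne_zero 2 (sinh_pos_iff.2 hx).ne'
  have hlim : Tendsto F (𝓝[>] 0) (𝓝 (1 / 8 - y ^ 2 / 2)) := by
    have h1 : Tendsto (fun ξ : ℝ => (1 / (4 * a)) * ξ ^ 2 / cosh (ξ / 2) ^ 2 + 1 / 8)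
        (𝓝[>] 0) (𝓝 (1 / 8)) := by
      have : ContinuousAt (fun ξ : ℝ => (1 / (4 * a)) * ξ ^ 2 / cosh (ξ / 2) ^ 2 + 1 / 8) 0 :=
        (ContinuousAt.div (by fun_prop) (by fun_prop) (by simp)).add continuousAt_const
      simpa [ContinuousAt] using this.tendsto.mono_left nhdsWithin_le_nhds
    have h2 := h1.sub ((tendsto_div_sinh.pow 2).const_mul (y ^ 2 / 2))
    simp only [one_pow, mul_one, div_pow, ← mul_div_assoc] at h2
    exact h2
  have hneg : 1 / 8 - y ^ 2 / 2 < 0 := by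
    have := sq_abs y
    nlinarith
  have hb : 0 < 8 * |y| := by linarith
  obtain ⟨ε, hε, hεI⟩ := ((hlim.eventually (gt_mem_nhds hneg)).and
    (Ioc_mem_nhdsGT hb)).exists
  have hsinh : ∀ x : ℝ, 0 ≤ x → x ^ 2 / 4 ≤ sinh x := fun x hx => by
    rw [sinh_eq]
    linarith [quadratic_le_exp_of_nonneg hx, exp_le_one_iff.2 (neg_nonpos.2 hx)]
  have hpos : 0 ≤ F (8 * |y|) := by
    have h1 : (y ^ 2 / 2) * (8 * |y|) ^ 2 / sinh (8 * |y|) ^ 2 ≤ 1 / 8 := by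
      have hs : 0 < sinh (8 * |y|) := sinh_pos_iff.2 hb
      rw [div_le_iff₀ (by positivity)]
      have h2 := hsinh (8 * |y|) hb.le
      have h3 := pow_le_pow_left₀ (by positivity) h2 2
      have h4 := sq_abs y
      nlinarith
    have h2 : 0 ≤ (1 / (4 * a)) * (8 * |y|) ^ 2 / cosh (8 * |y| / 2) ^ 2 := by positivity
    simp only [hF]
    linarith
  obtain ⟨ξ, hξ, hξ0⟩ := intermediate_value_Icc hεI.2
    (hcont.mono fun x hx => hεI.1.trans_le hx.1) ⟨hε.le, hpos⟩
  exact ⟨ξ, hεI.1.trans_le hξ.1, hξ0⟩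

theorem exists_trigonometric_root {a y : ℝ} (ha : 0 < a) (hy : |y| < 1 / 2) :
    ∃ l ∈ Ioo 0 (π / 2),
        -(1 / a) * l ^ 2 / cos l ^ 2 + 1 / 8
          - (y ^ 2 / 2) * (2 * l) ^ 2 / sin (2 * l) ^ 2 = 0 := by
  set F : ℝ → ℝ := fun l => -(1 / a) * l ^ 2 / cos l ^ 2 + 1 / 8
          - (y ^ 2 / 2) * (2 * l) ^ 2 / sin (2 * l) ^ 2 with hF
  have hcos : ∀ l ∈ Ioo 0 (π / 2), 0 < cos l := fun l hl =>
    cos_pos_of_mem_Ioo ⟨by linarith [hl.1, pi_pos], hl.2⟩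
  have hcont : ContinuousOn F (Ioo 0 (π / 2)) := by
    refine ContinuousOn.sub (ContinuousOn.add (ContinuousOn.div (by fun_prop) (by fun_prop) ?_)
      continuousOn_const) (ContinuousOn.div (by fun_prop) (by fun_prop) ?_)
    · exact fun l hl => pow_ne_zero 2 (hcos l hl).ne'
    · exact fun l hl => pow_ne_zero 2 (sin_pos_of_pos_of_lt_pi (by linarith [hl.1])
        (by linarith [hl.2])).ne'
  have hlim : Tendsto F (𝓝[>] 0) (𝓝 (1 / 8 - y ^ 2 / 2)) := by
    have h1 : Tendsto (fun l : ℝ => -(1 / a) * l ^ 2 / cos l ^ 2 + 1 / 8)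
        (𝓝[>] 0) (𝓝 (1 / 8)) := by
      have : ContinuousAt (fun l : ℝ => -(1 / a) * l ^ 2 / cos l ^ 2 + 1 / 8) 0 :=
        (ContinuousAt.div (by fun_prop) (by fun_prop) (by simp)).add continuousAt_const
      simpa [ContinuousAt] using this.tendsto.mono_left nhdsWithin_le_nhds
    have hdouble : Tendsto (fun l : ℝ => 2 * l) (𝓝[>] 0) (𝓝[>] 0) := by
      refine tendsto_nhdsWithin_iff.2 ⟨?_, ?_⟩
      · have : Tendsto (fun l : ℝ => 2 * l) (𝓝 0) (𝓝 (2 * 0)) := Continuous.tendsto (by fun_prop) 0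
        rw [mul_zero] at this
        exact this.mono_left nhdsWithin_le_nhds
      · filter_upwards [self_mem_nhdsWithin] with l (hl : 0 < l) using mul_pos two_pos hl
    have h2 := h1.sub (((tendsto_div_sin.comp hdouble).pow 2).const_mul (y ^ 2 / 2))
    simp only [Function.comp_def, one_pow, mul_one, div_pow, ← mul_div_assoc] at h2
    exact h2
  have hpos : 0 < 1 / 8 - y ^ 2 / 2 := by
    have := sq_abs y
    nlinarith [abs_nonneg y]
  have hcoslim : Tendsto (fun l => cos l ^ 2) (𝓝[<] (π / 2)) (𝓝 0) := by
    have : Tendsto (fun l => cos l ^ 2) (𝓝 (π / 2)) (𝓝 (cos (π / 2) ^ 2)) :=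
      Continuous.tendsto (by fun_prop) _
    rw [cos_pi_div_two, zero_pow two_ne_zero] at this
    exact this.mono_left nhdsWithin_le_nhds
  obtain ⟨b, hb, hbI⟩ := ((hcoslim.eventually (gt_mem_nhds (div_pos (by norm_num : (0 : ℝ) < 8)
    ha))).and (Ioo_mem_nhdsLT (show (1 : ℝ) < π / 2 by linarith [pi_gt_three]))).exists
  have hb0 : 0 < b := one_pos.trans hbI.1
  have hneg : F b ≤ 0 := by
    have hc := hcos b ⟨hb0, hbI.2⟩
    have h1 : 1 / 8 ≤ (1 / a) * b ^ 2 / cos b ^ 2 := by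
      rw [lt_div_iff₀ ha] at hb
      rw [one_div_mul_eq_div, div_div, le_div_iff₀ (by positivity)]
      nlinarith [hbI.1]
    have h2 : 0 ≤ (y ^ 2 / 2) * (2 * b) ^ 2 / sin (2 * b) ^ 2 := by positivity
    simp only [hF, neg_mul, neg_div]
    linarith
  obtain ⟨ε, hε, hεI⟩ := ((hlim.eventually (lt_mem_nhds hpos)).and (Ioc_mem_nhdsGT hb0)).exists
  obtain ⟨l, hl, hl0⟩ := intermediate_value_Icc' hεI.2
    (hcont.mono fun x hx => ⟨hεI.1.trans_le hx.1, hx.2.trans_lt hbI.2⟩) ⟨hneg, hε.le⟩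
  exact ⟨l, ⟨hεI.1.trans_le hl.1, hl.2.trans_lt hbI.2⟩, hl0⟩

end

/-- Explicit form of the zero-correlation rate function `J_X(y;a,0)` in the three cases
`|y| > 1/2`, `|y| < 1/2` and `|y| = 1/2`. -/
theorem ratefun_JX_explicit (a : ℝ) (ha : 0 < a)
    (JX : ℝ → ℝ)
    (hJX : ∀ y : ℝ, JX y =
      sInf {r : ℝ | ∃ u v : ℝ, 0 < u ∧ 0 < v ∧
        r = (1 / 2) * ratefun u v + (a / u) * (y + u / 2) ^ 2}) :
    -- Case 1: `|y| > 1/2`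
    (∀ y : ℝ, 1 / 2 < |y| →
      (∃ ξ : ℝ, 0 < ξ ∧
        (1 / (4 * a)) * ξ ^ 2 / Real.cosh (ξ / 2) ^ 2 + 1 / 8
          - (y ^ 2 / 2) * ξ ^ 2 / Real.sinh ξ ^ 2 = 0) ∧
      (∀ ξ : ℝ, 0 < ξ →
        (1 / (4 * a)) * ξ ^ 2 / Real.cosh (ξ / 2) ^ 2 + 1 / 8
          - (y ^ 2 / 2) * ξ ^ 2 / Real.sinh ξ ^ 2 = 0 →
        JX y = ξ ^ 2 / 2 - ξ * Real.tanh (ξ / 2)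
          + a * (ξ / Real.sinh ξ) * (y + Real.sinh ξ / (2 * ξ)) ^ 2)) ∧
    -- Case 2: `|y| < 1/2`
    (∀ y : ℝ, |y| < 1 / 2 →
      (∃ lam : ℝ, lam ∈ Set.Ioo 0 (Real.pi / 2) ∧
        -(1 / a) * lam ^ 2 / Real.cos lam ^ 2 + 1 / 8
          - (y ^ 2 / 2) * (2 * lam) ^ 2 / Real.sin (2 * lam) ^ 2 = 0) ∧
      (∀ lam : ℝ, lam ∈ Set.Ioo 0 (Real.pi / 2) →
        -(1 / a) * lam ^ 2 / Real.cos lam ^ 2 + 1 / 8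
          - (y ^ 2 / 2) * (2 * lam) ^ 2 / Real.sin (2 * lam) ^ 2 = 0 →
        JX y = 2 * lam * (Real.tan lam - lam)
          + a * (2 * lam / Real.sin (2 * lam)) * (y + Real.sin (2 * lam) / (4 * lam)) ^ 2)) ∧
    -- Case 3: `|y| = 1/2`
    (JX (-(1 / 2)) = 0 ∧ JX (1 / 2) = a) := by
  refine ⟨fun y hy => ⟨exists_hyperbolic_root ha hy, fun ξ hξ hroot => ?_⟩,
    fun y hy => ⟨exists_trigonometric_root ha hy, fun l hl hroot => ?_⟩, ?_, ?_⟩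
  · have hc : 0 < cosh (ξ / 2) := cosh_pos _
    have hs : 0 < sinh (ξ / 2) := sinh_pos_iff.2 (half_pos hξ)
    have hd : sinh ξ = 2 * sinh (ξ / 2) * cosh (ξ / 2) := by
      rw [← sinh_two_mul, mul_div_cancel₀ _ two_ne_zero]
    rw [hd] at hroot
    rw [hJX, (isExtremalPair_sinh (half_pos hξ)).sInf_eq ha, tanh_eq_sinh_div_cosh, hd]
    · simp only [mul_one]
      field_simp
    · simp only [mul_one]
      field_simp at hroot ⊢
      linear_combination (1 / 8) * hroot
  · have hl0 := hl.1
    have hc : 0 < cos l := cos_pos_of_mem_Ioo ⟨by linarith [Real.pi_pos], hl.2⟩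
    have hs : 0 < sin l := sin_pos_of_pos_of_lt_pi hl0 (by linarith [hl.2, Real.pi_pos])
    rw [sin_two_mul] at hroot
    rw [hJX, (isExtremalPair_sin hl).sInf_eq ha, tan_eq_sin_div_cos, sin_two_mul]
    · simp only [mul_one]
      field_simp
      ring
    · simp only [mul_one]
      field_simp at hroot ⊢
      linear_combination (1 / 2) * hroot
  · rw [hJX, isExtremalPair_id.sInf_eq ha (by norm_num)]
    norm_num
  · rw [hJX, isExtremalPair_id.sInf_eq ha (by norm_num)]
    norm_num
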